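/- arXiv:1703.00681 — 3 statements merged into one kernel-verified Lean document; each statement's English description precedes it below -/
import Mathlib

section
/- Suppose (p_m)_{m≥0} is a sequence of polynomials with rational coefficients such that p_0 = 1, such that for every m ≥ 1 one has the identity p_m(X) − p_m(X − 1) = (1/2)·(m − 1/2 − 2X)·p_{m−1}(X − 1) of polynomials in X, and such that p_m(0) = p_m(−1/2) for every m ≥ 0. Then p_m = Q_m for every m ≥ 0. -/
open Polynomial

/-- The polynomial `Q_m` with rational coefficients:
`Q_m = ((-1)^m / (2^m * m!)) * ∏_{k=1}^{2m} (X + 1 - k/2)`. -/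
noncomputable def Qpoly (m : ℕ) : Polynomial ℚ :=
  C ((-1) ^ m / (2 ^ m * (Nat.factorial m : ℚ))) *
    ∏ k ∈ Finset.Icc 1 (2 * m), (X + C (1 - (k : ℚ) / 2))

theorem Polynomial.eval_eq_eval_zero_of_eval_sub_one {f : ℚ[X]}
    (hf : ∀ a, f.eval a = f.eval (a - 1)) (a : ℚ) : f.eval a = f.eval 0 := by
  have hnat : ∀ n : ℕ, f.eval (n : ℚ) = f.eval 0 := by
    intro n
    induction n with
    | zero => simp
    | succ n ih => rw [hf, ← ih]; push_cast; congr 1; ring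
  have hconst : f = C (f.eval 0) := by
    apply Polynomial.eq_of_infinite_eval_eq
    refine (Set.infinite_range_of_injective (Nat.cast_injective (R := ℚ))).mono ?_
    rintro _ ⟨n, rfl⟩
    simpa using hnat n
  rw [hconst]
  simp

theorem Qpoly_eval (m : ℕ) (a : ℚ) :
    (Qpoly m).eval a = (-1) ^ m / (2 ^ m * (Nat.factorial m : ℚ)) *
      ∏ k ∈ Finset.range (2 * m), (a + (1 - ((k : ℚ) + 1) / 2)) := by
  rw [Qpoly, ← Finset.Ico_add_one_right_eq_Icc, Finset.prod_Ico_eq_prod_range]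
  simp [eval_prod, add_comm (1 : ℚ)]

theorem Qpoly_succ_eval (m : ℕ) (a : ℚ) :
    (Qpoly (m + 1)).eval a =
      -(a * (a + 1 / 2)) / (2 * (m + 1)) * (Qpoly m).eval (a - 1) := by
  have hfac : (Nat.factorial m : ℚ) ≠ 0 := by exact_mod_cast Nat.factorial_ne_zero m
  have hm : (m : ℚ) + 1 ≠ 0 := by positivity
  rw [Qpoly_eval, Qpoly_eval, show 2 * (m + 1) = 2 * m + 1 + 1 by ring,
    Finset.prod_range_succ', Finset.prod_range_succ', Nat.factorial_succ]
  have hprod : ∏ k ∈ Finset.range (2 * m), (a + (1 - (((k + 1 + 1 : ℕ) : ℚ) + 1) / 2)) =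
      ∏ k ∈ Finset.range (2 * m), (a - 1 + (1 - ((k : ℚ) + 1) / 2)) :=
    Finset.prod_congr rfl fun k _ => by push_cast; ring
  rw [hprod]
  push_cast
  field_simp
  ring

theorem Qpoly_succ_eval_sub_one (m : ℕ) (a : ℚ) :
    (Qpoly (m + 1)).eval (a - 1) =
      -((a - (m + 1)) * (a - (m + 1 / 2))) / (2 * (m + 1)) * (Qpoly m).eval (a - 1) := by
  have hfac : (Nat.factorial m : ℚ) ≠ 0 := by exact_mod_cast Nat.factorial_ne_zero m
  have hm : (m : ℚ) + 1 ≠ 0 := by positivity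
  rw [Qpoly_eval, Qpoly_eval, show 2 * (m + 1) = 2 * m + 1 + 1 by ring,
    Finset.prod_range_succ, Finset.prod_range_succ, Nat.factorial_succ]
  push_cast
  field_simp
  ring

theorem Qpoly_eval_sub_eval_sub_one (m : ℕ) (a : ℚ) :
    (Qpoly (m + 1)).eval a - (Qpoly (m + 1)).eval (a - 1) =
      1 / 2 * ((m : ℚ) + 1 / 2 - 2 * a) * (Qpoly m).eval (a - 1) := by
  have hm : (m : ℚ) + 1 ≠ 0 := by positivity
  rw [Qpoly_succ_eval, Qpoly_succ_eval_sub_one]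
  field_simp
  ring

/-- A sequence of rational polynomials satisfying `p_0 = 1`, the difference recursion
`p_m(X) - p_m(X-1) = (1/2)(m - 1/2 - 2X) p_{m-1}(X-1)` for all `m ≥ 1`, and
`p_m(0) = p_m(-1/2)` for all `m ≥ 0`, must coincide with `(Q_m)`. -/
theorem Q_uniqueness (p : ℕ → Polynomial ℚ)
    (h0 : p 0 = 1)
    (hrec : ∀ m : ℕ, 1 ≤ m →
      p m - (p m).comp (X - 1) =
        C ((1 : ℚ) / 2) * (C ((m : ℚ) - 1 / 2) - 2 * X) * ((p (m - 1)).comp (X - 1)))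
    (hval : ∀ m : ℕ, (p m).eval 0 = (p m).eval (-(1 / 2))) :
    ∀ m : ℕ, p m = Qpoly m := by
  have hp : ∀ (m : ℕ) (a : ℚ), (p (m + 1)).eval a - (p (m + 1)).eval (a - 1) =
      1 / 2 * ((m : ℚ) + 1 / 2 - 2 * a) * (p m).eval (a - 1) := by
    intro m a
    have h := congrArg (eval a) (hrec (m + 1) (by omega))
    simp only [eval_sub, eval_comp, eval_mul, eval_C, eval_X, eval_one, eval_ofNat,
      Nat.add_sub_cancel] at h
    rw [h]
    push_cast
    ring
  intro m
  induction m with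
  | zero => simp [h0, Qpoly]
  | succ m ih =>
    set c : ℚ := (p (m + 1) - Qpoly (m + 1)).eval 0 with hc
    have hdiff : ∀ a, (p (m + 1)).eval a - (Qpoly (m + 1)).eval a = c := by
      intro a
      rw [hc, ← eval_sub]
      refine eval_eq_eval_zero_of_eval_sub_one (fun b => ?_) a
      have h₁ := hp m b
      have h₂ := Qpoly_eval_sub_eval_sub_one m b
      rw [ih] at h₁
      simp only [eval_sub]
      linarith
    have hquad := eval_eq_eval_zero_of_eval_sub_one
      (f := p (m + 2) - Qpoly (m + 2) -
        C c * (C (-1 / 2) * X ^ 2 + C (((m : ℚ) + 1) / 2 - 1 / 4) * X)) (fun b => by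
          have h₁ := hp (m + 1) b
          have h₂ := Qpoly_eval_sub_eval_sub_one (m + 1) b
          simp only [eval_sub, eval_mul, eval_add, eval_pow, eval_C, eval_X]
          push_cast at h₁ h₂
          linear_combination h₁ - h₂ +
            1 / 2 * ((m : ℚ) + 1 + 1 / 2 - 2 * b) * hdiff (b - 1)) (-(1 / 2))
    have hQ₀ := Qpoly_succ_eval (m + 1) 0
    have hQ₁ := Qpoly_succ_eval (m + 1) (-(1 / 2))
    have hv := hval (m + 2)
    simp only [zero_mul, neg_zero, zero_div, neg_add_cancel, one_div, mul_zero] at hQ₀ hQ₁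
    simp only [eval_sub, eval_mul, eval_add, eval_pow, eval_C, eval_X] at hquad
    have hcm : ((m : ℚ) + 1) * c = 0 := by
      norm_num at hquad hv hQ₁
      rw [hQ₀, hQ₁] at hquad
      linarith
    have hc0 : c = 0 := (mul_eq_zero.mp hcm).resolve_left (by positivity)
    refine Polynomial.funext fun a => ?_
    linarith [hdiff a]
end

section
/- Let n ≥ 3 be an integer and let c_0, c_1, c_2 be rational numbers. Let M be the (n+1)×(n+1) matrix over ℚ, with rows and columns indexed by 0, 1, …, n, defined as follows: row 0 is (c_0, 1, 1, …, 1); for each i with 1 ≤ i ≤ n − 1, row i has first entry c_1, second entry 1, entry 0 in column i + 1, and entry 1 in every other column; row n has first entry c_2, second entry 1, entries 0 in columns 2 and 3, and entry 1 in columns 4 through n. Then M is invertible if and only if c_0 − 2·c_1 + c_2 ≠ 0. -/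
/-- Let `n ≥ 3` and let `M` be the `(n+1) × (n+1)` rational matrix (rows and columns
indexed by `0, …, n`) whose row `0` is `(c₀, 1, …, 1)`; whose row `i`, for `1 ≤ i ≤ n-1`,
has first entry `c₁`, second entry `1`, a `0` in column `i+1`, and `1` in every other
column; and whose row `n` has first entry `c₂`, second entry `1`, entries `0` in columns
`2` and `3`, and `1` in columns `4` through `n`.  Then `M` is invertible if and only if
`c₀ - 2·c₁ + c₂ ≠ 0`. -/
theorem relation_matrix_invertible_iff (n : ℕ) (hn : 3 ≤ n) (c₀ c₁ c₂ : ℚ)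
    (M : Matrix (Fin (n + 1)) (Fin (n + 1)) ℚ)
    (hM : ∀ i j : Fin (n + 1), M i j =
      if (j : ℕ) = 0 then
        (if (i : ℕ) = 0 then c₀ else if (i : ℕ) = n then c₂ else c₁)
      else if (i : ℕ) = 0 then 1
      else if (i : ℕ) = n then
        (if (j : ℕ) = 2 ∨ (j : ℕ) = 3 then 0 else 1)
      else
        (if (j : ℕ) = (i : ℕ) + 1 then 0 else 1)) :
    IsUnit M ↔ c₀ - 2 * c₁ + c₂ ≠ 0 := by
  have combination : M 0 - M ⟨1, by omega⟩ - M ⟨2, by omega⟩ + M (Fin.last n) =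
      Pi.single 0 (c₀ - 2 * c₁ + c₂) := by
    funext j
    simp only [Pi.add_apply, Pi.sub_apply, hM, Pi.single_apply, Fin.ext_iff, Fin.val_zero,
      Fin.val_last]
    grind
  have difference (i : ℕ) (hi : 1 ≤ i) (hin : i < n) :
      M 0 - M ⟨i, by omega⟩ =
        Pi.single 0 (c₀ - c₁) + Pi.single (⟨i + 1, by omega⟩ : Fin (n + 1)) 1 := by
    funext j
    simp only [Pi.add_apply, Pi.sub_apply, hM, Pi.single_apply, Fin.ext_iff, Fin.val_zero]
    grind
  constructor
  · intro hunit hd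
    rw [hd, Pi.single_zero] at combination
    have hw : (Pi.single 0 1 - Pi.single ⟨1, by omega⟩ 1 - Pi.single ⟨2, by omega⟩ 1 +
        Pi.single (Fin.last n) 1 : Fin (n + 1) → ℚ) = 0 := by
      apply Matrix.vecMul_injective_iff_isUnit.mpr hunit
      simp only [Matrix.add_vecMul, Matrix.sub_vecMul, Matrix.single_one_vecMul,
        Matrix.zero_vecMul]
      exact combination
    have h0 := congrFun hw 0
    simp only [Pi.add_apply, Pi.sub_apply, Pi.single_apply, Fin.ext_iff, Fin.val_zero,
      Fin.val_last, Pi.zero_apply] at h0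
    grind
  · intro hd
    rw [← Matrix.mulVec_injective_iff_isUnit, ← Matrix.coe_mulVecLin,
      ← LinearMap.ker_eq_bot, LinearMap.ker_eq_bot']
    intro v hv
    have hrow (i : Fin (n + 1)) : M i ⬝ᵥ v = 0 := congrFun hv i
    have hv0 : v 0 = 0 := by
      have h := congrArg (· ⬝ᵥ v) combination
      simp only [add_dotProduct, sub_dotProduct, hrow, single_dotProduct] at h
      simpa [hd] using h.symm
    have hv_succ (i : ℕ) (hi : 1 ≤ i) (hin : i < n) : v ⟨i + 1, by omega⟩ = 0 := by
      have h := congrArg (· ⬝ᵥ v) (difference i hi hin)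
      simp only [add_dotProduct, sub_dotProduct, hrow, single_dotProduct, hv0] at h
      simpa using h.symm
    have hv_ne_one (j : Fin (n + 1)) (hj : j ≠ ⟨1, by omega⟩) : v j = 0 := by
      obtain ⟨_ | _ | j, hjn⟩ := j
      · exact hv0
      · exact absurd rfl hj
      · exact hv_succ (j + 1) (by omega) (by omega)
    have hv1 : v ⟨1, by omega⟩ = 0 := by
      have h := hrow 0
      rw [dotProduct, Finset.sum_eq_single ⟨1, by omega⟩
        (fun j _ hj => by rw [hv_ne_one j hj, mul_zero]) (by simp), hM] at h
      simpa using h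
    funext j
    by_cases hj : j = ⟨1, by omega⟩
    · rw [hj, hv1, Pi.zero_apply]
    · exact hv_ne_one j hj
end

section
/- For all integers g and n satisfying 3 ≤ n ≤ g − 1 one has ĉ_0 − 2·ĉ_1 + ĉ_2 ≠ 0. -/
/-- `ĉ₀` (defined via `(3/4)·ĉ₀ = …`). -/
def chat0 (g n : ℚ) : ℚ :=
  (4 / 3) * ((3 * g / 2 - 9 / 4 + 3 * n / 2) * (2 * g - 1 / 2 - n / 2) /
      ((g - 1 / 2 + n / 2) * (g - 1 + n / 2))
    - (2 * g + 1 / 2 - n / 2) * (2 * g - 1 / 2 - n / 2) / (g - 1 + n / 2)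
    + (3 * g + 5 / 2 - 3 * n))

/-- `ĉ₁` (defined via `(3/4)·ĉ₁ = …`). -/
def chat1 (g n : ℚ) : ℚ :=
  (4 / 3) * ((3 * g / 2 - 15 / 4 + 3 * n / 2) * (2 * g - 1 - n / 2) /
      ((g - 1 + n / 2) * (g - 3 / 2 + n / 2))
    - (2 * g - n / 2) * (2 * g - 1 - n / 2) / (g - 3 / 2 + n / 2)
    + (3 * g + 5 / 2 - 3 * n))

/-- `ĉ₂` (defined via `(3/4)·ĉ₂ = …`). -/
def chat2 (g n : ℚ) : ℚ :=
  (4 / 3) * ((3 * g / 2 - 21 / 4 + 3 * n / 2) * (2 * g - 3 / 2 - n / 2) /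
      ((g - 3 / 2 + n / 2) * (g - 2 + n / 2))
    - (2 * g - 1 / 2 - n / 2) * (2 * g - 3 / 2 - n / 2) / (g - 2 + n / 2)
    + (3 * g + 5 / 2 - 3 * n))

/-- The second difference of the `ĉᵢ` as a single fraction. -/
theorem chat_second_difference_eq (g n : ℚ) (h₁ : 2 * g + n - 1 ≠ 0) (h₂ : 2 * g + n - 2 ≠ 0)
    (h₃ : 2 * g + n - 3 ≠ 0) (h₄ : 2 * g + n - 4 ≠ 0) :
    chat0 g n - 2 * chat1 g n + chat2 g n =
      8 / 3 * (3 * (g - n) * (2 * g + 1) * (2 * g + n - 4)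
          - (2 * (g - n) + 1) * (3 * g + (g - n)) * (2 * g + n - 1)) /
        ((2 * g + n - 1) * (2 * g + n - 2) * (2 * g + n - 3) * (2 * g + n - 4)) := by
  obtain ⟨m, rfl⟩ : ∃ m, n = m - 2 * g := ⟨n + 2 * g, by ring⟩
  rw [add_sub_cancel] at h₁ h₂ h₃ h₄ ⊢
  have e₁ : g - 1 / 2 + (m - 2 * g) / 2 = (m - 1) / 2 := by ring
  have e₂ : g - 1 + (m - 2 * g) / 2 = (m - 2) / 2 := by ring
  have e₃ : g - 3 / 2 + (m - 2 * g) / 2 = (m - 3) / 2 := by ring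
  have e₄ : g - 2 + (m - 2 * g) / 2 = (m - 4) / 2 := by ring
  unfold chat0 chat1 chat2
  rw [e₁, e₂, e₃, e₄]
  field_simp
  ring

/-- For all integers `g`, `n` with `3 ≤ n ≤ g - 1` one has `ĉ₀ - 2ĉ₁ + ĉ₂ ≠ 0`. -/
theorem chat_combination_ne_zero (g n : ℤ) (hn : 3 ≤ n) (hg : n ≤ g - 1) :
    chat0 (g : ℚ) (n : ℚ) - 2 * chat1 (g : ℚ) (n : ℚ) + chat2 (g : ℚ) (n : ℚ) ≠ 0 := by
  have hn' : (3 : ℚ) ≤ n := by exact_mod_cast hn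
  have hg' : (n : ℚ) ≤ g - 1 := by exact_mod_cast hg
  have h₁ : (0 : ℚ) < 2 * g + n - 1 := by linarith
  have h₂ : (0 : ℚ) < 2 * g + n - 2 := by linarith
  have h₃ : (0 : ℚ) < 2 * g + n - 3 := by linarith
  have h₄ : (0 : ℚ) < 2 * g + n - 4 := by linarith
  rw [chat_second_difference_eq _ _ h₁.ne' h₂.ne' h₃.ne' h₄.ne']
  have hk : (0 : ℚ) < g - n := by linarith
  have hgpos : (0 : ℚ) < g := by linarith
  have hcoef : 3 * ((g : ℚ) - n) * (2 * g + 1) < (2 * (g - n) + 1) * (3 * g + (g - n)) := by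
    nlinarith [mul_pos hk hk]
  have hlt : 3 * ((g : ℚ) - n) * (2 * g + 1) * (2 * g + n - 4) <
      (2 * (g - n) + 1) * (3 * g + (g - n)) * (2 * g + n - 1) :=
    mul_lt_mul'' hcoef (by linarith) (by positivity) h₄.le
  exact div_ne_zero (mul_ne_zero (by norm_num) (sub_ne_zero.mpr hlt.ne)) (by positivity)
end
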